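/- arXiv:2002.08538 — 3 statements merged into one kernel-verified Lean document; each statement's English description precedes it below -/
import Mathlib

section
/- Let d ≥ 1, θ⋆ ∈ ℝ^d, r > 0, 0 < α ≤ β and ν ≥ 0 with r ≥ 5ν/α. Let L_D and L̂ be real-valued functions on ℝ^d, differentiable on the closed Euclidean ball B(θ⋆,r), such that for all θ ∈ B(θ⋆,r): (i) ⟨θ−θ⋆, ∇L_D(θ)⟩ ≥ α‖θ−θ⋆‖², (ii) ‖∇L_D(θ)‖ ≤ β‖θ−θ⋆‖, and (iii) ‖∇L̂(θ) − ∇L_D(θ)‖ ≤ ν + (α/2)‖θ−θ⋆‖. Set the learning rate η = α/(16β²), pick θ_0 ∈ B(θ⋆,r), and define the gradient descent iterates θ_{τ+1} = θ_τ − η∇L̂(θ_τ). Then every iterate θ_τ lies in B(θ⋆,r) and for all τ ≥ 0, ‖θ_τ − θ⋆‖ ≤ (1 − α²/(128β²))^τ ‖θ_0 − θ⋆‖ + 5ν/α. -/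
open Metric
open scoped RealInnerProductSpace

/-- The scalar one-step estimate. -/
lemma scalar_step (x y s q : ℝ) (hx : 0 ≤ x) (hs : 0 ≤ s) (hq : 0 < q)
    (hq1 : q ≤ 1)
    (h : y ^ 2 ≤ x ^ 2 - q / 8 * (x ^ 2 / 2 - s * x) + q / 256 * (3 / 2 * x + s) ^ 2) :
    y ≤ 5 * s ∨ y ≤ (1 - q / 128) * x + q / 128 * (5 * s) := by
  rcases le_total x (2 * s) with hc | hc
  · left
    refine le_trans (le_abs_self _) (abs_le_of_sq_le_sq ?_ (by positivity))
    have h1 : x ^ 2 ≤ 4 * s ^ 2 := by nlinarith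
    have h2 : s * x ≤ 2 * s ^ 2 := by nlinarith
    have h3 : q * s ^ 2 ≤ s ^ 2 := by nlinarith [sq_nonneg s]
    have h4 : q * (s * x) ≤ q * (2 * s ^ 2) := mul_le_mul_of_nonneg_left h2 hq.le
    have h5 : q * x ^ 2 ≤ q * (4 * s ^ 2) := mul_le_mul_of_nonneg_left h1 hq.le
    have h6 : 0 ≤ q * x ^ 2 := by positivity
    nlinarith
  · right
    have hp : 0 ≤ (1 - q / 128) * x + q / 128 * (5 * s) := by
      have : 0 ≤ (1 - q / 128) * x := mul_nonneg (by linarith) hx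
      positivity
    refine le_trans (le_abs_self _) (abs_le_of_sq_le_sq ?_ hp)
    refine h.trans ?_
    have h1 : s ^ 2 * 4 ≤ x ^ 2 := by nlinarith
    have h2 : s * x * 2 ≤ x ^ 2 := by nlinarith
    have h4 : q * (s * x * 2) ≤ q * x ^ 2 := mul_le_mul_of_nonneg_left h2 hq.le
    have h5 : q * (s ^ 2 * 4) ≤ q * x ^ 2 := mul_le_mul_of_nonneg_left h1 hq.le
    have h7 : 0 ≤ q ^ 2 * (x - 5 * s) ^ 2 := by positivity
    have h8 : 0 ≤ q * (1 - q) * (s * x) :=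
      mul_nonneg (mul_nonneg hq.le (by linarith)) (mul_nonneg hs hx)
    have h9 : 0 ≤ q * x ^ 2 := by positivity
    nlinarith

/-- The vector one-step estimate. -/
lemma vector_step {E : Type*} [NormedAddCommGroup E] [InnerProductSpace ℝ E]
    (v g G : E) (α β ν : ℝ) (hα : 0 < α) (hαβ : α ≤ β) (hν : 0 ≤ ν)
    (h1 : α * ‖v‖ ^ 2 ≤ ⟪v, g⟫) (h2 : ‖g‖ ≤ β * ‖v‖)
    (h3 : ‖G - g‖ ≤ ν + (α / 2) * ‖v‖) :
    ‖v - (α / (16 * β ^ 2)) • G‖ ≤ 5 * (ν / α) ∨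
    ‖v - (α / (16 * β ^ 2)) • G‖ ≤
      (1 - (α ^ 2 / β ^ 2) / 128) * ‖v‖ + (α ^ 2 / β ^ 2) / 128 * (5 * (ν / α)) := by
  have hβ : 0 < β := hα.trans_le hαβ
  have hv := norm_nonneg v
  apply scalar_step _ _ _ _ hv (by positivity) (by positivity)
  · rw [div_le_one (by positivity)]
    gcongr
  obtain ⟨s, rfl⟩ : ∃ s, ν = α * s := ⟨ν / α, by field_simp⟩
  have hs : 0 ≤ s := nonneg_of_mul_nonneg_right hν hα
  have e1 : α * s / α = s := by field_simp
  rw [e1]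
  have hi : α * (‖v‖ ^ 2 / 2 - s * ‖v‖) ≤ ⟪v, G⟫ := by
    have : ⟪v, G⟫ = ⟪v, g⟫ + ⟪v, G - g⟫ := by rw [inner_sub_right]; ring
    have h4 := neg_le_of_abs_le (abs_real_inner_le_norm v (G - g))
    have h5 := mul_le_mul_of_nonneg_left h3 hv
    nlinarith
  have hG : ‖G‖ ≤ β * (3 / 2 * ‖v‖ + s) := by
    have h4 : ‖G‖ ≤ ‖g‖ + ‖G - g‖ := by
      simpa using norm_add_le g (G - g)
    have h5 := mul_le_mul_of_nonneg_right hαβ hv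
    have h6 := mul_le_mul_of_nonneg_right hαβ hs
    nlinarith
  have hG2 : ‖G‖ ^ 2 ≤ (β * (3 / 2 * ‖v‖ + s)) ^ 2 := by gcongr
  rw [norm_sub_sq_real, inner_smul_right, norm_smul, Real.norm_of_nonneg (by positivity), mul_pow]
  have hη : 0 ≤ α / (16 * β ^ 2) := by positivity
  have a1 := mul_le_mul_of_nonneg_left hi hη
  have a2 := mul_le_mul_of_nonneg_left hG2 (sq_nonneg (α / (16 * β ^ 2)))
  have b1 : α / (16 * β ^ 2) * (α * (‖v‖ ^ 2 / 2 - s * ‖v‖))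
      = α ^ 2 / β ^ 2 / 16 * (‖v‖ ^ 2 / 2 - s * ‖v‖) := by field_simp
  have b2 : (α / (16 * β ^ 2)) ^ 2 * (β * (3 / 2 * ‖v‖ + s)) ^ 2
      = α ^ 2 / β ^ 2 / 256 * (3 / 2 * ‖v‖ + s) ^ 2 := by
    field_simp
    ring
  rw [b1] at a1
  rw [b2] at a2
  linarith

/-- **Gradient descent convergence under one-point convexity** (Theorem: OPC convergence).
If the population loss `LD` is one-point convex toward `θ⋆` with parameter `α` and `β`-smooth
at `θ⋆` on the closed ball `B(θ⋆, r)`, and the empirical gradient `∇L̂` is uniformly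
`ν + (α/2)‖θ − θ⋆‖`-close to `∇L_D` on that ball, then gradient descent on `L̂` with step size
`α/(16β²)` stays in the ball and converges linearly up to the residual `5ν/α`. -/
theorem stmt0
    {d : ℕ} (hd : 1 ≤ d) (θstar : EuclideanSpace ℝ (Fin d)) (r : ℝ) (hr : 0 < r)
    (α β ν : ℝ) (hα : 0 < α) (hαβ : α ≤ β) (hν : 0 ≤ ν) (hrν : 5 * ν / α ≤ r)
    (LD Lhat : EuclideanSpace ℝ (Fin d) → ℝ)
    (hLDdiff : ∀ θ ∈ closedBall θstar r, DifferentiableAt ℝ LD θ)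
    (hLhatdiff : ∀ θ ∈ closedBall θstar r, DifferentiableAt ℝ Lhat θ)
    (hOPC : ∀ θ ∈ closedBall θstar r,
      α * ‖θ - θstar‖ ^ 2 ≤ ⟪θ - θstar, gradient LD θ⟫)
    (hSmooth : ∀ θ ∈ closedBall θstar r, ‖gradient LD θ‖ ≤ β * ‖θ - θstar‖)
    (hGradDiff : ∀ θ ∈ closedBall θstar r,
      ‖gradient Lhat θ - gradient LD θ‖ ≤ ν + (α / 2) * ‖θ - θstar‖)
    (θseq : ℕ → EuclideanSpace ℝ (Fin d)) (hθ0 : θseq 0 ∈ closedBall θstar r)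
    (hiter : ∀ τ : ℕ, θseq (τ + 1) = θseq τ - (α / (16 * β ^ 2)) • gradient Lhat (θseq τ)) :
    ∀ τ : ℕ, θseq τ ∈ closedBall θstar r ∧
      ‖θseq τ - θstar‖ ≤ (1 - α ^ 2 / (128 * β ^ 2)) ^ τ * ‖θseq 0 - θstar‖ + 5 * ν / α := by
  have hβ : 0 < β := hα.trans_le hαβ
  have hc : α ^ 2 / (128 * β ^ 2) = (α ^ 2 / β ^ 2) / 128 := by field_simp
  have hs5 : 5 * ν / α = 5 * (ν / α) := by ring
  have hs : 0 ≤ ν / α := by positivity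
  have hq1 : α ^ 2 / β ^ 2 ≤ 1 := by
    rw [div_le_one (by positivity)]
    gcongr
  have hq : 0 ≤ α ^ 2 / β ^ 2 := by positivity
  rw [hc, hs5]
  rw [hs5] at hrν
  intro τ
  induction τ with
  | zero =>
    refine ⟨hθ0, ?_⟩
    simp only [pow_zero, one_mul]
    linarith
  | succ k ih =>
    obtain ⟨hb, hk⟩ := ih
    have hstep := vector_step _ _ _ α β ν hα hαβ hν (hOPC _ hb) (hSmooth _ hb) (hGradDiff _ hb)
    have e : θseq (k + 1) - θstar
        = θseq k - θstar - (α / (16 * β ^ 2)) • gradient Lhat (θseq k) := by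
      rw [hiter]; abel
    rw [← e] at hstep
    rw [mem_closedBall, dist_eq_norm] at hb ⊢
    generalize α ^ 2 / β ^ 2 = q at *
    generalize ν / α = s at *
    have hc0 : 0 ≤ 1 - q / 128 := by linarith
    rcases hstep with h | h
    · refine ⟨h.trans hrν, h.trans ?_⟩
      have : 0 ≤ (1 - q / 128) ^ (k + 1) * ‖θseq 0 - θstar‖ := by positivity
      linarith
    · constructor
      · have a1 := mul_le_mul_of_nonneg_left hb hc0
        have a2 := mul_le_mul_of_nonneg_left hrν (show 0 ≤ q / 128 by positivity)
        linarith
      · have a1 := mul_le_mul_of_nonneg_left hk hc0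
        rw [pow_succ]
        linarith
end

section
/- Let d ≥ 1, θ⋆ ∈ ℝ^d, r > 0, 0 < α ≤ β and ν ≥ 0. Let ∇L_D, ∇L̂ : ℝ^d → ℝ^d be maps satisfying, at a point θ ∈ B(θ⋆,r): (i) ⟨θ−θ⋆, ∇L_D(θ)⟩ ≥ α‖θ−θ⋆‖², (ii) ‖∇L_D(θ)‖ ≤ β‖θ−θ⋆‖, and (iii) ‖∇L̂(θ) − ∇L_D(θ)‖ ≤ ν + (α/2)‖θ−θ⋆‖. Suppose additionally ‖θ − θ⋆‖ ≥ 4ν/α, and set η = α/(16β²) and θ⁺ = θ − η∇L̂(θ). Then ‖θ⁺ − θ⋆‖² ≤ (1 − α²/(64β²)) ‖θ − θ⋆‖². -/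
open Metric
open scoped RealInnerProductSpace

/-- **Single-step contraction of gradient descent in the far regime.**
At a point `θ` of the ball `B(θ⋆,r)` where one-point convexity, smoothness and the gradient
deviation bound hold, and where `‖θ − θ⋆‖ ≥ 4ν/α`, one gradient step with learning rate
`η = α/(16β²)` contracts the squared distance to `θ⋆` by the factor `1 − α²/(64β²)`. -/
theorem stmt1
    {d : ℕ} (hd : 1 ≤ d) (θstar θ : EuclideanSpace ℝ (Fin d)) (r : ℝ) (hr : 0 < r)
    (α β ν : ℝ) (hα : 0 < α) (hαβ : α ≤ β) (hν : 0 ≤ ν)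
    (gLD gLhat : EuclideanSpace ℝ (Fin d) → EuclideanSpace ℝ (Fin d))
    (hθ : θ ∈ closedBall θstar r)
    (hOPC : α * ‖θ - θstar‖ ^ 2 ≤ ⟪θ - θstar, gLD θ⟫)
    (hSmooth : ‖gLD θ‖ ≤ β * ‖θ - θstar‖)
    (hGradDiff : ‖gLhat θ - gLD θ‖ ≤ ν + (α / 2) * ‖θ - θstar‖)
    (hfar : 4 * ν / α ≤ ‖θ - θstar‖) :
    ‖(θ - (α / (16 * β ^ 2)) • gLhat θ) - θstar‖ ^ 2 ≤
      (1 - α ^ 2 / (64 * β ^ 2)) * ‖θ - θstar‖ ^ 2 := by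
  have hβ : 0 < β := lt_of_lt_of_le hα hαβ
  set u := θ - θstar with hu
  set g := gLhat θ with hg
  set η := α / (16 * β ^ 2) with hη
  have hx : 0 ≤ ‖u‖ := norm_nonneg u
  have hηpos : 0 < η := by positivity
  have hν4 : 4 * ν ≤ ‖u‖ * α := (div_le_iff₀ hα).1 hfar
  have he : ‖g - gLD θ‖ ≤ 3 / 4 * α * ‖u‖ := by linarith
  have hcs : -(‖u‖ * ‖g - gLD θ‖) ≤ ⟪u, g - gLD θ⟫ :=
    (abs_le.1 (abs_real_inner_le_norm u (g - gLD θ))).1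
  have hmul : ‖u‖ * ‖g - gLD θ‖ ≤ ‖u‖ * (3 / 4 * α * ‖u‖) :=
    mul_le_mul_of_nonneg_left he hx
  have hin : α / 4 * ‖u‖ ^ 2 ≤ ⟪u, g⟫ := by
    rw [inner_sub_right] at hcs
    nlinarith
  have hgn : ‖g‖ ≤ 7 / 4 * β * ‖u‖ := by
    have h1 : ‖g‖ ≤ ‖g - gLD θ‖ + ‖gLD θ‖ := by
      simpa using norm_add_le (g - gLD θ) (gLD θ)
    have h2 : α * ‖u‖ ≤ β * ‖u‖ := mul_le_mul_of_nonneg_right hαβ hx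
    linarith
  have hg2 : ‖g‖ ^ 2 ≤ (7 / 4 * β * ‖u‖) ^ 2 := pow_le_pow_left₀ (norm_nonneg g) hgn 2
  have hexp : ‖(θ - η • g) - θstar‖ ^ 2 = ‖u‖ ^ 2 - 2 * η * ⟪u, g⟫ + η ^ 2 * ‖g‖ ^ 2 := by
    have h : (θ - η • g) - θstar = u - η • g := by rw [hu]; abel
    rw [h, norm_sub_sq_real, inner_smul_right, norm_smul, Real.norm_eq_abs, mul_pow, sq_abs]
    ring
  have h1 : η * (α / 4 * ‖u‖ ^ 2) ≤ η * ⟪u, g⟫ := mul_le_mul_of_nonneg_left hin hηpos.le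
  have h2 : η ^ 2 * ‖g‖ ^ 2 ≤ η ^ 2 * (7 / 4 * β * ‖u‖) ^ 2 :=
    mul_le_mul_of_nonneg_left hg2 (by positivity)
  have e1 : η * (α / 4 * ‖u‖ ^ 2) = 1 / 64 * (α ^ 2 / β ^ 2 * ‖u‖ ^ 2) := by
    rw [hη]; field_simp; ring
  have e2 : η ^ 2 * (7 / 4 * β * ‖u‖) ^ 2 = 49 / 4096 * (α ^ 2 / β ^ 2 * ‖u‖ ^ 2) := by
    rw [hη]; field_simp; ring
  have e3 : (1 - α ^ 2 / (64 * β ^ 2)) * ‖u‖ ^ 2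
      = ‖u‖ ^ 2 - 1 / 64 * (α ^ 2 / β ^ 2 * ‖u‖ ^ 2) := by
    field_simp
  have hK : 0 ≤ α ^ 2 / β ^ 2 * ‖u‖ ^ 2 := by positivity
  rw [hexp, e3]
  linarith
end

section
/- Let d ≥ 1, θ⋆ ∈ ℝ^d, r > 0, 0 < α ≤ β and ν ≥ 0. Let ∇L_D, ∇L̂ : ℝ^d → ℝ^d be maps satisfying, at a point θ ∈ B(θ⋆,r): (i) ⟨θ−θ⋆, ∇L_D(θ)⟩ ≥ α‖θ−θ⋆‖², (ii) ‖∇L_D(θ)‖ ≤ β‖θ−θ⋆‖, and (iii) ‖∇L̂(θ) − ∇L_D(θ)‖ ≤ ν + (α/2)‖θ−θ⋆‖. Suppose additionally ‖θ − θ⋆‖ ≤ 4ν/α, and set η = α/(16β²) and θ⁺ = θ − η∇L̂(θ). Then ‖θ⁺ − θ⋆‖ ≤ 5ν/α. -/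
open Metric
open scoped RealInnerProductSpace

/-- **Single-step boundedness of gradient descent in the near regime.**
At a point `θ` of the ball `B(θ⋆,r)` where one-point convexity, smoothness and the gradient
deviation bound hold, and where `‖θ − θ⋆‖ ≤ 4ν/α`, one gradient step with learning rate
`η = α/(16β²)` lands within distance `5ν/α` of `θ⋆`. -/
theorem stmt2
    {d : ℕ} (hd : 1 ≤ d) (θstar θ : EuclideanSpace ℝ (Fin d)) (r : ℝ) (hr : 0 < r)
    (α β ν : ℝ) (hα : 0 < α) (hαβ : α ≤ β) (hν : 0 ≤ ν)
    (gLD gLhat : EuclideanSpace ℝ (Fin d) → EuclideanSpace ℝ (Fin d))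
    (hθ : θ ∈ closedBall θstar r)
    (hOPC : α * ‖θ - θstar‖ ^ 2 ≤ ⟪θ - θstar, gLD θ⟫)
    (hSmooth : ‖gLD θ‖ ≤ β * ‖θ - θstar‖)
    (hGradDiff : ‖gLhat θ - gLD θ‖ ≤ ν + (α / 2) * ‖θ - θstar‖)
    (hclose : ‖θ - θstar‖ ≤ 4 * ν / α) :
    ‖(θ - (α / (16 * β ^ 2)) • gLhat θ) - θstar‖ ≤ 5 * ν / α := by
  have hβ : 0 < β := lt_of_lt_of_le hα hαβ
  obtain ⟨η, hη⟩ : ∃ η, η = α / (16 * β ^ 2) := ⟨_, rfl⟩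
  rw [← hη]
  have hη0 : 0 < η := by rw [hη]; positivity
  have hηβ : η * β ^ 2 = α / 16 := by rw [hη]; field_simp
  have hηα : η * α ≤ 1 / 16 := by
    rw [hη, div_mul_eq_mul_div, div_le_iff₀ (by positivity)]
    nlinarith
  have hx0 : 0 ≤ ‖θ - θstar‖ := norm_nonneg _
  have h1 : ‖(θ - θstar) - η • gLD θ‖ ≤ ‖θ - θstar‖ := by
    refine (sq_le_sq₀ (norm_nonneg _) hx0).1 ?_
    rw [norm_sub_sq_real, inner_smul_right, norm_smul, Real.norm_of_nonneg hη0.le]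
    have h2 : ‖gLD θ‖ ^ 2 ≤ (β * ‖θ - θstar‖) ^ 2 :=
      pow_le_pow_left₀ (norm_nonneg _) hSmooth 2
    have h3 : η ^ 2 * ‖gLD θ‖ ^ 2 ≤ η ^ 2 * (β * ‖θ - θstar‖) ^ 2 :=
      mul_le_mul_of_nonneg_left h2 (by positivity)
    have h4 : η ^ 2 * (β * ‖θ - θstar‖) ^ 2 = η * (α / 16) * ‖θ - θstar‖ ^ 2 := by
      rw [← hηβ]; ring
    have h5 := mul_le_mul_of_nonneg_left hOPC hη0.le
    have h6 : 0 ≤ η * α * ‖θ - θstar‖ ^ 2 := by positivity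
    nlinarith
  have h7 : (θ - η • gLhat θ) - θstar
      = ((θ - θstar) - η • gLD θ) - η • (gLhat θ - gLD θ) := by
    rw [smul_sub]; abel
  have h8 : ‖η • (gLhat θ - gLD θ)‖ ≤ η * (3 * ν) := by
    rw [norm_smul, Real.norm_of_nonneg hη0.le]
    apply mul_le_mul_of_nonneg_left _ hη0.le
    rw [le_div_iff₀ hα] at hclose
    linarith
  have h9 : η * (3 * ν) ≤ ν / α := by
    rw [le_div_iff₀ hα]
    nlinarith
  have h10 : 5 * ν / α = 4 * ν / α + ν / α := by ring
  rw [h7, h10]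
  exact (norm_sub_le _ _).trans (add_le_add (h1.trans hclose) (h8.trans h9))
end
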